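/- arXiv:1507.04986 — 3 statements merged into one kernel-verified Lean document; each statement's English description precedes it below -/
import Mathlib

section
/- Let h>0 and let u : ℤ → ℝ be bounded. Then for every j ∈ ℤ, the limit as s→1⁻ of (−Δ_h)^s u_j := h^{−2s} ∑_{m≠j} (u_j − u_m) K_s(j−m) equals −Δ_h u_j = −(u_{j+1} − 2u_j + u_{j−1})/h². -/
open Real Filter

/-- The kernel of the one-dimensional fractional discrete Laplacian. -/
noncomputable def Ks (s : ℝ) (m : ℤ) : ℝ :=
  if m = 0 then 0
  else 4 ^ s * Real.Gamma (1 / 2 + s) * Real.Gamma (|(m : ℝ)| - s) /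
    (Real.sqrt Real.pi * |Real.Gamma (-s)| * Real.Gamma (|(m : ℝ)| + 1 + s))

/-- The fractional discrete Laplacian on the mesh `hℤ`:
`(−Δ_h)^s u_j = h^{−2s} ∑_{m ≠ j} (u_j − u_m) K_s(j−m)`. -/
noncomputable def fracDiscLap (s h : ℝ) (u : ℤ → ℝ) (j : ℤ) : ℝ :=
  h ^ (-(2 * s)) * ∑' m : ℤ, (u j - u m) * Ks s (j - m)

theorem Ks_natAbs (s : ℝ) (m : ℤ) : Ks s (m.natAbs : ℤ) = Ks s m := by
  simp [Ks]

theorem Ks_one {s : ℝ} (hs : s ∈ Set.Ioo (0 : ℝ) 1) :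
    Ks s 1 = 4 ^ s * Gamma (1 / 2 + s) * s / (√π * Gamma (2 + s)) := by
  obtain ⟨h0, h1⟩ := hs
  have hG : Gamma (1 - s) = -s * Gamma (-s) := by
    rw [← Gamma_add_one (neg_ne_zero.mpr h0.ne')]
    congr 1
    ring
  have hpos : 0 < Gamma (1 - s) := Gamma_pos_of_pos (by linarith)
  have hneg : Gamma (-s) < 0 := by
    by_contra! h
    nlinarith [mul_nonneg h0.le h]
  have h2 : 0 < Gamma (2 + s) := Gamma_pos_of_pos (by linarith)
  have hpi : 0 < √π := sqrt_pos.mpr pi_pos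
  have e : (1 : ℝ) + 1 + s = 2 + s := by ring
  simp only [Ks, one_ne_zero, if_false, Int.cast_one, abs_one]
  rw [hG, abs_of_neg hneg, e]
  have := hneg.ne
  field_simp

theorem Ks_succ {s : ℝ} (hs : s ∈ Set.Ioo (0 : ℝ) 1) {n : ℕ} (hn : 1 ≤ n) :
    Ks s ((n + 1 : ℕ) : ℤ) = Ks s (n : ℤ) * ((n - s) / (n + 1 + s)) := by
  obtain ⟨h0, h1⟩ := hs
  have hn' : (1 : ℝ) ≤ n := by exact_mod_cast hn
  have a1 : Gamma ((n : ℝ) + 1 - s) = (n - s) * Gamma (n - s) := by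
    rw [← Gamma_add_one (by linarith)]
    congr 1
    ring
  have a2 : Gamma ((n : ℝ) + 1 + 1 + s) = (n + 1 + s) * Gamma (n + 1 + s) := by
    rw [← Gamma_add_one (by linarith)]
    congr 1
    ring
  have c1 : ((n + 1 : ℕ) : ℤ) ≠ 0 := by omega
  have c2 : (n : ℤ) ≠ 0 := by omega
  have e1 : |(((n + 1 : ℕ) : ℤ) : ℝ)| = n + 1 := by
    push_cast
    exact abs_of_nonneg (by linarith)
  have e2 : |((n : ℤ) : ℝ)| = n := by simp
  rw [Ks, Ks, if_neg c1, if_neg c2, e1, e2, a1, a2, div_mul_div_comm]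
  congr 1 <;> ring

theorem Ks_nonneg {s : ℝ} (hs : s ∈ Set.Ioo (0 : ℝ) 1) (m : ℤ) : 0 ≤ Ks s m := by
  obtain ⟨h0, h1⟩ := hs
  rw [Ks]
  split_ifs with hm
  · exact le_rfl
  have hm' : (1 : ℝ) ≤ |(m : ℝ)| := by exact_mod_cast Int.one_le_abs hm
  have g1 := Gamma_pos_of_pos (show 0 < 1 / 2 + s by linarith)
  have g2 := Gamma_pos_of_pos (show 0 < |(m : ℝ)| - s by linarith)
  have g3 := Gamma_pos_of_pos (show 0 < |(m : ℝ)| + 1 + s by linarith)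
  positivity

theorem Ks_le_Ks_one_div_sq {s : ℝ} (hs : s ∈ Set.Ioo (0 : ℝ) 1) (hs' : 1 / 2 ≤ s) (m : ℤ) :
    Ks s m ≤ Ks s 1 * (1 / (m : ℝ) ^ 2) := by
  by_cases hm : m = 0
  · simp [hm, Ks]
  have key : ∀ n : ℕ, 1 ≤ n → Ks s (n : ℤ) ≤ Ks s 1 * (1 / (n : ℝ) ^ 2) := by
    intro n hn
    induction n, hn using Nat.le_induction with
    | base => simp
    | succ n hn ih =>
      have hn' : (1 : ℝ) ≤ n := by exact_mod_cast hn
      have hratio : ((n : ℝ) - s) / (n + 1 + s) ≤ (n : ℝ) ^ 2 / (n + 1) ^ 2 := by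
        rw [div_le_div_iff₀ (by linarith [hs.1]) (by positivity)]
        nlinarith [mul_nonneg (sub_nonneg.mpr hs')
          (show (0 : ℝ) ≤ (n + 1) ^ 2 + n ^ 2 by positivity)]
      calc Ks s ((n + 1 : ℕ) : ℤ) = Ks s (n : ℤ) * ((n - s) / (n + 1 + s)) := Ks_succ hs hn
        _ ≤ Ks s (n : ℤ) * ((n : ℝ) ^ 2 / (n + 1) ^ 2) :=
          mul_le_mul_of_nonneg_left hratio (Ks_nonneg hs _)
        _ ≤ Ks s 1 * (1 / (n : ℝ) ^ 2) * ((n : ℝ) ^ 2 / (n + 1) ^ 2) :=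
          mul_le_mul_of_nonneg_right ih (by positivity)
        _ = Ks s 1 * (1 / ((n + 1 : ℕ) : ℝ) ^ 2) := by
          push_cast
          field_simp
  have := key m.natAbs (by omega)
  rwa [Ks_natAbs, Nat.cast_natAbs, Int.cast_abs, sq_abs] at this

theorem tendsto_Ks_one :
    Tendsto (fun s : ℝ => Ks s 1) (nhdsWithin 1 (Set.Ioo 0 1)) (nhds 1) := by
  have hG : ∀ x : ℝ, 0 < x → ContinuousAt Gamma x := fun x hx =>
    (differentiableAt_Gamma fun m => by
      have : (0 : ℝ) ≤ m := m.cast_nonneg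
      linarith).continuousAt
  have g1 : ContinuousAt (fun s : ℝ => Gamma (1 / 2 + s)) 1 :=
    ContinuousAt.comp (f := fun s : ℝ => 1 / 2 + s) (hG _ (by norm_num)) (by fun_prop)
  have g2 : ContinuousAt (fun s : ℝ => Gamma (2 + s)) 1 :=
    ContinuousAt.comp (f := fun s : ℝ => 2 + s) (hG _ (by norm_num)) (by fun_prop)
  have g3 : ContinuousAt (fun s : ℝ => (4 : ℝ) ^ s) 1 :=
    continuousAt_const_rpow (by norm_num)
  have v2 : Gamma (2 + 1) = 2 := by
    rw [Gamma_add_one (by norm_num), Gamma_two, mul_one]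
  have v1 : Gamma (1 / 2 + 1) = 1 / 2 * √π := by
    rw [Gamma_add_one (by norm_num), Gamma_one_half_eq]
  have hpi : √π ≠ 0 := (sqrt_pos.mpr pi_pos).ne'
  have hc : ContinuousAt
      (fun s : ℝ => 4 ^ s * Gamma (1 / 2 + s) * s / (√π * Gamma (2 + s))) 1 :=
    ((g3.mul g1).mul continuousAt_id).div (continuousAt_const.mul g2) (by simp [v2, hpi])
  have hval : (4 : ℝ) ^ (1 : ℝ) * Gamma (1 / 2 + 1) * 1 / (√π * Gamma (2 + 1)) = 1 := by
    rw [v1, v2, rpow_one]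
    field_simp
    norm_num
  have ht := hc.tendsto.mono_left (nhdsWithin_le_nhds (s := Set.Ioo 0 1))
  rw [hval] at ht
  refine ht.congr' ?_
  filter_upwards [self_mem_nhdsWithin] with s hs using (Ks_one hs).symm

theorem tendsto_Ks (m : ℤ) :
    Tendsto (fun s : ℝ => Ks s m) (nhdsWithin 1 (Set.Ioo 0 1))
      (nhds (if m.natAbs = 1 then 1 else 0)) := by
  have step : ∀ (n : ℕ) (L : ℝ), 1 ≤ n →
      Tendsto (fun s : ℝ => Ks s (n : ℤ)) (nhdsWithin 1 (Set.Ioo 0 1)) (nhds L) →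
      Tendsto (fun s : ℝ => Ks s ((n + 1 : ℕ) : ℤ)) (nhdsWithin 1 (Set.Ioo 0 1))
        (nhds (L * ((n - 1) / (n + 1 + 1)))) := by
    intro n L hn hL
    have hc : ContinuousAt (fun s : ℝ => ((n : ℝ) - s) / (n + 1 + s)) 1 :=
      ContinuousAt.div (by fun_prop) (by fun_prop) (by positivity)
    refine (hL.mul (hc.tendsto.mono_left nhdsWithin_le_nhds)).congr' ?_
    filter_upwards [self_mem_nhdsWithin] with s hs using (Ks_succ hs hn).symm
  have hzero : ∀ n : ℕ, 2 ≤ n →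
      Tendsto (fun s : ℝ => Ks s (n : ℤ)) (nhdsWithin 1 (Set.Ioo 0 1)) (nhds 0) := by
    intro n hn
    induction n, hn using Nat.le_induction with
    | base => simpa using step 1 1 le_rfl (by simpa using tendsto_Ks_one)
    | succ n hn ih => simpa using step n 0 (by omega) ih
  simp_rw [← Ks_natAbs _ m]
  generalize m.natAbs = n
  rcases n with _ | _ | n
  · simp [Ks]
  · simpa using tendsto_Ks_one
  · rw [if_neg (by omega)]
    exact hzero (n + 1 + 1) (by omega)

theorem fracDiscLap_tendsto_discLap_of_s_to_one (h : ℝ) (hh : 0 < h) (u : ℤ → ℝ)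
    (hu : ∃ M : ℝ, ∀ j : ℤ, |u j| ≤ M) (j : ℤ) :
    Tendsto (fun s : ℝ => fracDiscLap s h u j) (nhdsWithin 1 (Set.Ioo 0 1))
      (nhds (-((u (j + 1) - 2 * u j + u (j - 1)) / h ^ 2))) := by
  obtain ⟨M, hM⟩ := hu
  have hsummable : Summable fun m : ℤ => 2 * M * (2 * (1 / ((j - m : ℤ) : ℝ) ^ 2)) :=
    ((((Equiv.subLeft j).summable_iff (f := fun m : ℤ => 1 / (m : ℝ) ^ 2)).mpr
      (summable_one_div_int_pow.mpr one_lt_two)).mul_left 2).mul_left (2 * M)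
  have hsum : Tendsto (fun s : ℝ => ∑' m : ℤ, (u j - u m) * Ks s (j - m))
      (nhdsWithin 1 (Set.Ioo 0 1))
      (nhds (∑' m : ℤ, (u j - u m) * (if (j - m).natAbs = 1 then 1 else 0))) := by
    refine tendsto_tsum_of_dominated_convergence hsummable
      (fun m => (tendsto_Ks (j - m)).const_mul _) ?_
    filter_upwards [self_mem_nhdsWithin, tendsto_Ks_one.eventually_le_const one_lt_two,
      mem_nhdsWithin_of_mem_nhds (Ici_mem_nhds (show (1 / 2 : ℝ) < 1 by norm_num))]
      with s hs hK hs' m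
    rw [norm_mul, norm_eq_abs, norm_eq_abs, abs_of_nonneg (Ks_nonneg hs _)]
    have hdiff : |u j - u m| ≤ 2 * M := by linarith [abs_sub (u j) (u m), hM j, hM m]
    exact mul_le_mul hdiff ((Ks_le_Ks_one_div_sq hs hs' _).trans
      (mul_le_mul_of_nonneg_right hK (by positivity))) (Ks_nonneg hs _)
      ((abs_nonneg _).trans hdiff)
  have hval : ∑' m : ℤ, (u j - u m) * (if (j - m).natAbs = 1 then (1 : ℝ) else 0) =
      -(u (j + 1) - 2 * u j + u (j - 1)) := by
    rw [tsum_eq_sum (s := {j + 1, j - 1})]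
    · rw [Finset.sum_pair (by omega), if_pos (by omega), if_pos (by omega)]
      ring
    · intro m hm
      simp only [Finset.mem_insert, Finset.mem_singleton, not_or] at hm
      rw [if_neg (by omega), mul_zero]
  have hpow : Tendsto (fun s : ℝ => h ^ (-(2 * s))) (nhdsWithin 1 (Set.Ioo 0 1))
      (nhds (h ^ (-(2 * 1 : ℝ)))) :=
    ((continuousAt_const_rpow hh.ne').comp (f := fun s : ℝ => -(2 * s))
      (by fun_prop)).tendsto.mono_left nhdsWithin_le_nhds
  have e : h ^ (-(2 * 1 : ℝ)) = (h ^ 2)⁻¹ := by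
    rw [rpow_neg hh.le, mul_one, rpow_two]
  rw [hval] at hsum
  rw [e] at hpow
  have := hpow.mul hsum
  rwa [mul_comm, ← div_eq_mul_inv, neg_div] at this
end

section
/- Let 0<β≤1 and 0<s<1 with 2s<β. There exists a constant C>0 depending only on s and β such that for every h>0, every j ∈ ℤ, and every bounded function u : ℝ → ℝ with finite Hölder seminorm [u]_{C^{0,β}(ℝ)}, one has |(−Δ_h)^s (r_h u)_j − (−Δ)^s u(hj)| ≤ C [u]_{C^{0,β}(ℝ)} h^{β−2s}. -/
open Real MeasureTheory

/-- The normalizing constant `c_s = 4^s Γ(1/2+s)/(√π |Γ(−s)|)`. -/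
noncomputable def cs (s : ℝ) : ℝ :=
  4 ^ s * Real.Gamma (1 / 2 + s) / (Real.sqrt Real.pi * |Real.Gamma (-s)|)

/-- The fractional Laplacian on `ℝ`, written in second-difference form:
`(−Δ)^s u(x) = (c_s/2) ∫_ℝ (2u(x) − u(x+y) − u(x−y)) / |y|^{1+2s} dy`. -/
noncomputable def fracLap (s : ℝ) (u : ℝ → ℝ) (x : ℝ) : ℝ :=
  (cs s / 2) * ∫ y : ℝ, (2 * u x - u (x + y) - u (x - y)) / |y| ^ (1 + 2 * s)

open Set Filter Topology

lemma Gamma_add_le_rpow_mul_Gamma {x a : ℝ} (hx : 0 < x) (ha0 : 0 < a) (ha1 : a < 1) :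
    Real.Gamma (x + a) ≤ x ^ a * Real.Gamma x := by
  have hG := Real.Gamma_pos_of_pos hx
  have h := Real.Gamma_mul_add_mul_le_rpow_Gamma_mul_rpow_Gamma hx
    (by linarith : 0 < x + 1) (sub_pos.2 ha1) ha0 (by ring)
  rw [Real.Gamma_add_one hx.ne', Real.mul_rpow hx.le hG.le] at h
  calc Real.Gamma (x + a) = Real.Gamma ((1 - a) * x + a * (x + 1)) := by congr 1; ring
    _ ≤ _ := h
    _ = x ^ a * (Real.Gamma x ^ (1 - a) * Real.Gamma x ^ a) := by ring
    _ = x ^ a * Real.Gamma x := by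
      rw [← Real.rpow_add hG, sub_add_cancel, Real.rpow_one]

lemma rpow_neg_le_Gamma_div_Gamma {s x : ℝ} (hs0 : 0 < s) (hs1 : 2 * s < 1) (hx : 1 ≤ x) :
    (x + 1) ^ (-(1 + 2 * s)) ≤ Real.Gamma (x - s) / Real.Gamma (x + 1 + s) := by
  have h := Gamma_add_le_rpow_mul_Gamma (x := x - s) (a := 2 * s) (by linarith) (by linarith) hs1
  have hG := Real.Gamma_pos_of_pos (by linarith : 0 < x - s)
  rw [le_div_iff₀ (Real.Gamma_pos_of_pos (by linarith)), Real.rpow_neg (by linarith),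
    inv_mul_le_iff₀ (by positivity)]
  calc Real.Gamma (x + 1 + s) = (x + s) * Real.Gamma (x - s + 2 * s) := by
        rw [show x + 1 + s = (x + s) + 1 by ring, Real.Gamma_add_one (by linarith)]
        congr 2; ring
    _ ≤ (x + 1) * ((x + 1) ^ (2 * s) * Real.Gamma (x - s)) := by
        gcongr
        · exact (Real.Gamma_pos_of_pos (by linarith)).le
        · linarith
        · refine h.trans ?_
          gcongr <;> linarith
    _ = _ := by rw [Real.rpow_add (by linarith), Real.rpow_one]; ring

lemma Gamma_div_Gamma_le_rpow_neg {s x : ℝ} (hs0 : 0 < s) (hs1 : 2 * s < 1) (hx : 1 ≤ x) :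
    Real.Gamma (x - s) / Real.Gamma (x + 1 + s) ≤ (x - 1 / 2) ^ (-(1 + 2 * s)) := by
  have hxs : 0 < x + s := by linarith
  have h := Gamma_add_le_rpow_mul_Gamma hxs (a := 1 - 2 * s) (by linarith) (by linarith)
  have hG := Real.Gamma_pos_of_pos hxs
  rw [show x + s + (1 - 2 * s) = (x - s) + 1 by ring, Real.Gamma_add_one (by linarith),
    ← le_div_iff₀' (by linarith)] at h
  rw [show x + 1 + s = (x + s) + 1 by ring, Real.Gamma_add_one hxs.ne',
    div_le_iff₀ (by positivity)]
  have hpos : 0 < x - 1 / 2 := by linarith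
  have h1 : (x + s) ^ (-(2 * s)) ≤ (x - 1 / 2) ^ (-(2 * s)) :=
    Real.rpow_le_rpow_of_nonpos hpos (by linarith) (by linarith)
  calc Real.Gamma (x - s) ≤ (x + s) ^ (1 - 2 * s) * Real.Gamma (x + s) / (x - s) := h
    _ = (x - s)⁻¹ * (x + s) ^ (-(2 * s)) * ((x + s) * Real.Gamma (x + s)) := by
        rw [show 1 - 2 * s = -(2 * s) + 1 by ring, Real.rpow_add hxs, Real.rpow_one]; ring
    _ ≤ (x - 1 / 2)⁻¹ * (x - 1 / 2) ^ (-(2 * s)) * ((x + s) * Real.Gamma (x + s)) := by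
        gcongr; linarith
    _ = _ := by
        rw [show -(1 + 2 * s) = -1 + -(2 * s) by ring, Real.rpow_add hpos, Real.rpow_neg_one]

lemma rpow_neg_sub_rpow_neg_le {a b p : ℝ} (ha : 0 < a) (hab : a ≤ b) (hp : 1 ≤ p) :
    a ^ (-p) - b ^ (-p) ≤ p * a ^ (-p) * ((b - a) / b) := by
  have hb : 0 < b := ha.trans_le hab
  have h := one_add_mul_self_le_rpow_one_add (s := a / b - 1)
    (by have : 0 < a / b := by positivity
        linarith) hp
  rw [add_sub_cancel, Real.div_rpow ha.le hb.le] at h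
  have hap : 0 < a ^ p := by positivity
  have h2 : a ^ (-p) * (a ^ p / b ^ p) = b ^ (-p) := by
    rw [Real.rpow_neg ha.le, Real.rpow_neg hb.le]; field_simp
  have h3 := mul_le_mul_of_nonneg_left h (Real.rpow_nonneg ha.le (-p))
  rw [h2] at h3
  have h4 : (b - a) / b = -(a / b - 1) := by field_simp; ring
  rw [h4]; linarith

lemma abs_rpow_neg_sub_Gamma_div_Gamma_le {s x t : ℝ} (hs0 : 0 < s) (hs1 : 2 * s < 1)
    (hx : 1 ≤ x) (hxt : x ≤ t) (htx : t ≤ x + 1) :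
    |t ^ (-(1 + 2 * s)) - Real.Gamma (x - s) / Real.Gamma (x + 1 + s)| ≤
      12 * x ^ (-(1 + 2 * s)) * x⁻¹ := by
  have hpos : 0 < x - 1 / 2 := by linarith
  have h1 := rpow_neg_le_Gamma_div_Gamma hs0 hs1 hx
  have h2 := Gamma_div_Gamma_le_rpow_neg hs0 hs1 hx
  have h3 : (x + 1) ^ (-(1 + 2 * s)) ≤ t ^ (-(1 + 2 * s)) :=
    Real.rpow_le_rpow_of_nonpos (by linarith) htx (by linarith)
  have h4 : t ^ (-(1 + 2 * s)) ≤ (x - 1 / 2) ^ (-(1 + 2 * s)) :=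
    Real.rpow_le_rpow_of_nonpos hpos (by linarith) (by linarith)
  have h5 := rpow_neg_sub_rpow_neg_le hpos (by linarith : x - 1 / 2 ≤ x + 1)
    (by linarith : 1 ≤ 1 + 2 * s)
  have h6 : (x - 1 / 2) ^ (-(1 + 2 * s)) ≤ 4 * x ^ (-(1 + 2 * s)) := by
    calc (x - 1 / 2) ^ (-(1 + 2 * s)) ≤ (x / 2) ^ (-(1 + 2 * s)) :=
          Real.rpow_le_rpow_of_nonpos (by linarith) (by linarith) (by linarith)
      _ = 2 ^ (1 + 2 * s) * x ^ (-(1 + 2 * s)) := by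
          rw [Real.div_rpow (by linarith) (by norm_num), Real.rpow_neg (by norm_num : (0:ℝ) ≤ 2)]
          field_simp
      _ ≤ 2 ^ (2 : ℝ) * x ^ (-(1 + 2 * s)) := by
          gcongr
          · norm_num
          · linarith
      _ = _ := by norm_num
  have h7 : (x + 1 - (x - 1 / 2)) / (x + 1) ≤ 3 / 2 * x⁻¹ := by
    rw [← div_eq_mul_inv]
    gcongr <;> linarith
  have hxp : 0 < x ^ (-(1 + 2 * s)) := by positivity
  have h8 : (1 + 2 * s) * (x - 1 / 2) ^ (-(1 + 2 * s)) * ((x + 1 - (x - 1 / 2)) / (x + 1)) ≤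
      2 * (4 * x ^ (-(1 + 2 * s))) * (3 / 2 * x⁻¹) := by
    gcongr
    · apply div_nonneg <;> linarith
    · linarith
  rw [abs_le]
  constructor <;> linarith

lemma continuous_of_abs_sub_le_rpow {g : ℝ → ℝ} {A β : ℝ} (hβ0 : 0 < β)
    (hg : ∀ t r, |g t - g r| ≤ A * |t - r| ^ β) : Continuous g := by
  refine continuous_iff_continuousAt.2 fun r => tendsto_iff_dist_tendsto_zero.2 ?_
  refine squeeze_zero (fun _ => dist_nonneg) (fun t => hg t r) ?_
  have hc : Continuous fun t : ℝ => A * |t - r| ^ β :=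
    continuous_const.mul ((continuous_id.sub continuous_const).abs.rpow_const
      fun _ => Or.inr hβ0.le)
  have h := hc.tendsto r
  simpa [Real.zero_rpow hβ0.ne'] using h

lemma integrableOn_Ioi_mul_rpow_neg {g : ℝ → ℝ} {A M β p : ℝ} (hg : Continuous g)
    (hM : ∀ t, |g t| ≤ M) (hA : ∀ t, 0 < t → |g t| ≤ A * t ^ β) (hp1 : 1 < p)
    (hpβ : p < 1 + β) :
    IntegrableOn (fun t => g t * t ^ (-p)) (Ioi 0) := by
  have hmeas : Measurable fun t : ℝ => g t * t ^ (-p) := by fun_prop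
  rw [← Ioc_union_Ioi_eq_Ioi zero_le_one]
  refine IntegrableOn.union ?_ ?_
  · have h := (intervalIntegral.intervalIntegrable_rpow' (a := 0) (b := 1)
      (by linarith : -1 < β - p)).const_mul A
    rw [intervalIntegrable_iff_integrableOn_Ioc_of_le zero_le_one] at h
    refine Integrable.mono' h hmeas.aestronglyMeasurable ?_
    filter_upwards [ae_restrict_mem measurableSet_Ioc] with t ht
    have ht0 : 0 < t := ht.1
    rw [Real.norm_eq_abs, abs_mul, abs_of_pos (Real.rpow_pos_of_pos ht0 _), sub_eq_add_neg,
      Real.rpow_add ht0, ← mul_assoc]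
    gcongr
    exact hA t ht0
  · have h := (integrableOn_Ioi_rpow_of_lt (by linarith : -p < -1) one_pos).const_mul M
    refine Integrable.mono' h hmeas.aestronglyMeasurable ?_
    filter_upwards [ae_restrict_mem measurableSet_Ioi] with t ht
    have ht0 : 0 < t := one_pos.trans ht
    rw [Real.norm_eq_abs, abs_mul, abs_of_pos (Real.rpow_pos_of_pos ht0 _)]
    gcongr
    exact hM t

lemma summable_nat_add_one_rpow_neg {p : ℝ} (hp : 1 < p) :
    Summable fun n : ℕ => ((n : ℝ) + 1) ^ (-p) := by
  have h := (summable_nat_add_iff 1).2 (Real.summable_nat_rpow.2 (by linarith : -p < -1))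
  simpa using h

lemma summable_Gamma_div_Gamma {s : ℝ} (hs0 : 0 < s) (hs1 : 2 * s < 1) :
    Summable fun n : ℕ => Real.Gamma ((n : ℝ) + 1 - s) / Real.Gamma ((n : ℝ) + 1 + 1 + s) := by
  have hx : ∀ n : ℕ, (1 : ℝ) ≤ (n : ℝ) + 1 := fun n => by simp
  refine Summable.of_nonneg_of_le (fun n => ?_) (fun n => ?_)
    ((summable_nat_add_one_rpow_neg (by linarith : 1 < 1 + 2 * s)).mul_left 13)
  · exact (Real.rpow_nonneg (by positivity) _).trans (rpow_neg_le_Gamma_div_Gamma hs0 hs1 (hx n))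
  · have h := (abs_le.1 (abs_rpow_neg_sub_Gamma_div_Gamma_le hs0 hs1 (hx n) le_rfl
      (by linarith))).1
    have hi : ((n : ℝ) + 1)⁻¹ ≤ 1 := inv_le_one_of_one_le₀ (hx n)
    have hq : 0 ≤ 12 * ((n : ℝ) + 1) ^ (-(1 + 2 * s)) := by positivity
    have := mul_le_mul_of_nonneg_left hi hq
    linarith

lemma abs_sub_le_of_mem_Icc {g : ℝ → ℝ} {A β s x t : ℝ} (hβ0 : 0 < β) (hβ1 : β ≤ 1)
    (hA : 0 ≤ A) (hs0 : 0 < s) (hs1 : 2 * s < 1) (hx : 1 ≤ x) (hxt : x ≤ t) (htx : t ≤ x + 1)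
    (hgx : |g x| ≤ A * x ^ β) (hg : |g t - g x| ≤ A * |t - x| ^ β) :
    |g t * t ^ (-(1 + 2 * s)) - g x * (Real.Gamma (x - s) / Real.Gamma (x + 1 + s))| ≤
      13 * A * x ^ (-(1 + 2 * s)) := by
  have hx0 : 0 < x := by linarith
  have ht0 : 0 < t := by linarith
  have h1 := abs_rpow_neg_sub_Gamma_div_Gamma_le hs0 hs1 hx hxt htx
  have h2 : |t - x| ^ β ≤ 1 :=
    Real.rpow_le_one (abs_nonneg _) (abs_le.2 ⟨by linarith, by linarith⟩) hβ0.le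
  have h3 : t ^ (-(1 + 2 * s)) ≤ x ^ (-(1 + 2 * s)) :=
    Real.rpow_le_rpow_of_nonpos hx0 hxt (by linarith)
  have h4 : x ^ β ≤ x := by
    simpa using Real.rpow_le_rpow_of_exponent_le hx hβ1
  set q := Real.Gamma (x - s) / Real.Gamma (x + 1 + s)
  have hgt : |g t - g x| ≤ A := hg.trans (mul_le_of_le_one_right hA h2)
  have hgx' : |g x| ≤ A * x := hgx.trans (by gcongr)
  calc |g t * t ^ (-(1 + 2 * s)) - g x * q|
      = |(g t - g x) * t ^ (-(1 + 2 * s)) + g x * (t ^ (-(1 + 2 * s)) - q)| := by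
        congr 1; ring
    _ ≤ |g t - g x| * t ^ (-(1 + 2 * s)) + |g x| * |t ^ (-(1 + 2 * s)) - q| := by
        refine (abs_add_le _ _).trans_eq ?_
        rw [abs_mul, abs_mul, abs_of_pos (Real.rpow_pos_of_pos ht0 _)]
    _ ≤ A * x ^ (-(1 + 2 * s)) + A * x * (12 * x ^ (-(1 + 2 * s)) * x⁻¹) := by gcongr
    _ = _ := by field_simp; ring

theorem abs_tsum_sub_integral_le {g : ℝ → ℝ} {A M β s : ℝ} (hβ0 : 0 < β) (hβ1 : β ≤ 1)
    (hs0 : 0 < s) (hsβ : 2 * s < β) (hA : 0 ≤ A) (hM : ∀ t, |g t| ≤ M) (hg0 : g 0 = 0)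
    (hg : ∀ t r, |g t - g r| ≤ A * |t - r| ^ β) :
    |∑' n : ℕ, g (n + 1) *
        (Real.Gamma ((n : ℝ) + 1 - s) / Real.Gamma ((n : ℝ) + 1 + 1 + s)) -
      ∫ t in Ioi 0, g t * t ^ (-(1 + 2 * s))| ≤
    (1 / (β - 2 * s) + 13 * ∑' n : ℕ, ((n : ℝ) + 1) ^ (-(1 + 2 * s))) * A := by
  have hs1 : 2 * s < 1 := by linarith
  have hcont := continuous_of_abs_sub_le_rpow hβ0 hg
  have hgA : ∀ t, 0 < t → |g t| ≤ A * t ^ β := fun t ht => by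
    simpa [hg0, abs_of_pos ht] using hg t 0
  set f : ℝ → ℝ := fun t => g t * t ^ (-(1 + 2 * s)) with hf
  set q : ℕ → ℝ := fun n => Real.Gamma ((n : ℝ) + 1 - s) / Real.Gamma ((n : ℝ) + 1 + 1 + s)
    with hq
  have hq0 : ∀ n, 0 ≤ q n := fun n =>
    (Real.rpow_nonneg (by positivity) _).trans
      (rpow_neg_le_Gamma_div_Gamma hs0 hs1 (by simp : (1 : ℝ) ≤ (n : ℝ) + 1))
  have hint : IntegrableOn f (Ioi 0) :=
    integrableOn_Ioi_mul_rpow_neg hcont hM hgA (by linarith) (by linarith)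
  have hii : ∀ a b : ℝ, 0 ≤ a → a ≤ b → IntervalIntegrable f volume a b := fun a b ha hab =>
    (intervalIntegrable_iff_integrableOn_Ioc_of_le hab).2
      (hint.mono_set fun t ht => ha.trans_lt ht.1)
  have hsum : Summable fun n : ℕ => g (n + 1) * q n :=
    Summable.of_norm_bounded ((summable_Gamma_div_Gamma hs0 hs1).mul_left M) fun n => by
      rw [Real.norm_eq_abs, abs_mul, abs_of_nonneg (hq0 n)]
      exact mul_le_mul_of_nonneg_right (hM _) (hq0 n)
  have hS := summable_nat_add_one_rpow_neg (by linarith : 1 < 1 + 2 * s)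
  have hzero : |∫ t in (0 : ℝ)..1, f t| ≤ 1 / (β - 2 * s) * A := by
    have hb := (intervalIntegral.intervalIntegrable_rpow' (a := 0) (b := 1)
      (by linarith : -1 < β - (1 + 2 * s))).const_mul A
    have h := intervalIntegral.norm_integral_le_of_norm_le zero_le_one
      (f := f) (Eventually.of_forall fun t ht => ?_) hb
    · rw [intervalIntegral.integral_const_mul, integral_rpow (Or.inl (by linarith)),
        Real.zero_rpow (by linarith), Real.one_rpow] at h
      refine h.trans_eq ?_
      rw [show β - (1 + 2 * s) + 1 = β - 2 * s by ring]; ring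
    · have ht0 : 0 < t := ht.1
      rw [Real.norm_eq_abs, abs_mul, abs_of_pos (Real.rpow_pos_of_pos ht0 _), sub_eq_add_neg,
        Real.rpow_add ht0, ← mul_assoc]
      gcongr
      exact hgA t ht0
  have hcell : ∀ n : ℕ, |g (n + 1) * q n - ∫ t in ((n : ℝ) + 1)..((n + 1 : ℕ) : ℝ) + 1, f t| ≤
      13 * A * ((n : ℝ) + 1) ^ (-(1 + 2 * s)) := fun n => by
    have hn : (1 : ℝ) ≤ (n : ℝ) + 1 := by simp
    have hle : (n : ℝ) + 1 ≤ ((n + 1 : ℕ) : ℝ) + 1 := by push_cast; linarith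
    have hconst : ∫ _ in ((n : ℝ) + 1)..((n + 1 : ℕ) : ℝ) + 1, g (n + 1) * q n =
        g (n + 1) * q n := by
      rw [intervalIntegral.integral_const]; push_cast; simp
    rw [abs_sub_comm, ← hconst,
      ← intervalIntegral.integral_sub (hii _ _ (by positivity) hle) intervalIntegrable_const]
    refine (intervalIntegral.norm_integral_le_of_norm_le_const
      (f := fun t => f t - g (n + 1) * q n)
      (C := 13 * A * ((n : ℝ) + 1) ^ (-(1 + 2 * s))) fun t ht => ?_).trans_eq ?_
    · rw [uIoc_of_le hle] at ht
      refine abs_sub_le_of_mem_Icc hβ0 hβ1 hA hs0 hs1 hn ht.1.le ?_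
        (hgA _ (by positivity)) (hg _ _)
      have := ht.2
      push_cast at this
      exact this
    · push_cast; simp
  have htend := (hsum.hasSum.tendsto_sum_nat).sub (intervalIntegral_tendsto_integral_Ioi 0 hint
    (tendsto_atTop_add_const_right atTop (1 : ℝ) tendsto_natCast_atTop_atTop))
  refine le_of_tendsto htend.abs (Eventually.of_forall fun N => ?_)
  have hsplit : ∫ t in (0 : ℝ)..(N : ℝ) + 1, f t = (∫ t in (0 : ℝ)..1, f t) +
      ∑ n ∈ Finset.range N, ∫ t in ((n : ℝ) + 1)..((n + 1 : ℕ) : ℝ) + 1, f t := by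
    rw [intervalIntegral.sum_integral_adjacent_intervals (a := fun n : ℕ => (n : ℝ) + 1)
      fun k _ => hii _ _ (by positivity) (by push_cast; linarith)]
    simp only [Nat.cast_zero, zero_add]
    rw [intervalIntegral.integral_add_adjacent_intervals (hii _ _ le_rfl zero_le_one)
      (hii _ _ zero_le_one (by simp))]
  rw [hsplit, add_comm (∫ t in (0 : ℝ)..1, f t), ← sub_sub, ← Finset.sum_sub_distrib]
  have hbound : |∑ n ∈ Finset.range N, (g (n + 1) * q n -
      ∫ t in ((n : ℝ) + 1)..((n + 1 : ℕ) : ℝ) + 1, f t)| ≤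
      13 * A * ∑' n : ℕ, ((n : ℝ) + 1) ^ (-(1 + 2 * s)) := by
    refine (Finset.abs_sum_le_sum_abs _ _).trans ((Finset.sum_le_sum fun n _ => hcell n).trans ?_)
    rw [← Finset.mul_sum]
    gcongr
    exact hS.sum_le_tsum _ fun n _ => by positivity
  refine (abs_sub _ _).trans ((add_le_add hbound hzero).trans_eq ?_)
  ring

lemma Ks_neg (s : ℝ) (m : ℤ) : Ks s (-m) = Ks s m := by
  simp [Ks]

lemma Ks_natCast_add_one (s : ℝ) (n : ℕ) :
    Ks s ((n : ℤ) + 1) =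
      cs s * (Real.Gamma ((n : ℝ) + 1 - s) / Real.Gamma ((n : ℝ) + 1 + 1 + s)) := by
  have h : ((n : ℤ) + 1) ≠ 0 := by positivity
  have h' : |(((n : ℤ) + 1 : ℤ) : ℝ)| = (n : ℝ) + 1 := by
    push_cast; exact abs_of_pos (by positivity)
  rw [Ks, if_neg h, h', cs, div_mul_div_comm]

lemma fracDiscLap_eq {s : ℝ} (hs0 : 0 < s) (hs1 : 2 * s < 1) {h M : ℝ} (u : ℝ → ℝ) (j : ℤ)
    (hM : ∀ x, |u x| ≤ M) :
    fracDiscLap s h (fun m : ℤ => u (h * m)) j =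
      h ^ (-(2 * s)) * (cs s * ∑' n : ℕ,
        (2 * u (h * j) - u (h * j + h * (n + 1)) - u (h * j - h * (n + 1))) *
        (Real.Gamma ((n : ℝ) + 1 - s) / Real.Gamma ((n : ℝ) + 1 + 1 + s))) := by
  rw [fracDiscLap]
  congr 1
  have hK : Summable fun n : ℕ => Ks s ((n : ℤ) + 1) := by
    simp only [Ks_natCast_add_one]
    exact (summable_Gamma_div_Gamma hs0 hs1).mul_left _
  have hsum : ∀ a : ℕ → ℝ, (∀ n, |a n| ≤ M) →
      Summable fun n : ℕ => (u (h * j) - a n) * Ks s ((n : ℤ) + 1) := fun a ha =>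
    Summable.of_norm_bounded (hK.norm.mul_left (M + M)) fun n => by
      rw [norm_mul]
      gcongr
      exact (norm_sub_le _ _).trans (add_le_add (hM _) (ha n))
  have hp : Summable fun n : ℕ =>
      (u (h * j) - u (h * j - h * (n + 1))) * Ks s ((n : ℤ) + 1) := hsum _ fun n => hM _
  have hn : Summable fun n : ℕ =>
      (u (h * j) - u (h * j + h * (n + 1))) * Ks s ((n : ℤ) + 1) := hsum _ fun n => hM _
  set F : ℤ → ℝ := fun k => (u (h * j) - u (h * j - h * k)) * Ks s k with hF
  have hFp : (fun n : ℕ => F (n + 1)) = fun n : ℕ =>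
      (u (h * j) - u (h * j - h * (n + 1))) * Ks s ((n : ℤ) + 1) := by
    funext n; simp [hF]
  have hFn : (fun n : ℕ => F (-(n + 1))) = fun n : ℕ =>
      (u (h * j) - u (h * j + h * (n + 1))) * Ks s ((n : ℤ) + 1) := by
    funext n
    simp only [hF, Ks_neg]
    push_cast
    rw [mul_neg, sub_neg_eq_add]
  calc ∑' m : ℤ, (u (h * j) - u (h * m)) * Ks s (j - m) = ∑' k : ℤ, F k := by
        rw [← (Equiv.subLeft j).tsum_eq F]
        refine tsum_congr fun m => ?_
        simp only [hF, Equiv.subLeft_apply]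
        push_cast
        congr 3
        ring_nf
    _ = ∑' n : ℕ, ((u (h * j) - u (h * j - h * (n + 1))) * Ks s ((n : ℤ) + 1) +
          (u (h * j) - u (h * j + h * (n + 1))) * Ks s ((n : ℤ) + 1)) := by
        rw [tsum_of_add_one_of_neg_add_one (hFp ▸ hp) (hFn ▸ hn), hFp, hFn,
          hp.tsum_add hn]
        simp [hF]
    _ = _ := by
        rw [← tsum_mul_left]
        refine tsum_congr fun n => ?_
        rw [Ks_natCast_add_one]
        ring

lemma fracLap_eq {s h : ℝ} (hh : 0 < h) (u : ℝ → ℝ) (x : ℝ) :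
    fracLap s u x = h ^ (-(2 * s)) * (cs s * ∫ t in Ioi 0,
      (2 * u x - u (x + h * t) - u (x - h * t)) * t ^ (-(1 + 2 * s))) := by
  have hhs : h ^ (-(2 * s)) = h * h ^ (-(1 + 2 * s)) := by
    nth_rewrite 2 [← Real.rpow_one h]
    rw [← Real.rpow_add hh]; congr 1; ring
  set F : ℝ → ℝ := fun y => (2 * u x - u (x + y) - u (x - y)) * y ^ (-(1 + 2 * s)) with hF
  have h1 : ∀ y : ℝ, (2 * u x - u (x + y) - u (x - y)) / |y| ^ (1 + 2 * s) = F |y| := fun y => by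
    simp only [hF]
    rw [Real.rpow_neg (abs_nonneg y), ← div_eq_mul_inv]
    rcases abs_choice y with hy | hy <;> rw [hy]
    rw [sub_neg_eq_add, ← sub_eq_add_neg, sub_right_comm]
  have h2 : ∫ t in Ioi 0, F t = h * ∫ t in Ioi 0, F (h * t) := by
    have := integral_comp_mul_left_Ioi' F 0 hh
    rw [mul_zero, smul_eq_mul] at this
    exact this.symm
  have h3 : ∫ t in Ioi 0, F (h * t) = h ^ (-(1 + 2 * s)) * ∫ t in Ioi 0,
      (2 * u x - u (x + h * t) - u (x - h * t)) * t ^ (-(1 + 2 * s)) := by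
    rw [← integral_const_mul]
    refine setIntegral_congr_fun measurableSet_Ioi fun t ht => ?_
    simp only [hF]
    rw [Real.mul_rpow hh.le (le_of_lt ht)]
    ring
  simp only [fracLap, h1]
  rw [integral_comp_abs, h2, h3, hhs]
  ring

theorem consistency_Holder (β s : ℝ) (hβ0 : 0 < β) (hβ1 : β ≤ 1)
    (hs0 : 0 < s) (hs1 : s < 1) (hsβ : 2 * s < β) :
    ∃ C : ℝ, 0 < C ∧ ∀ (h : ℝ), 0 < h → ∀ (j : ℤ) (u : ℝ → ℝ) (L : ℝ),
      (∃ M : ℝ, ∀ x : ℝ, |u x| ≤ M) →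
      (∀ x y : ℝ, |u x - u y| ≤ L * |x - y| ^ β) →
      |fracDiscLap s h (fun m : ℤ => u (h * m)) j - fracLap s u (h * j)| ≤
        C * L * h ^ (β - 2 * s) := by
  set B : ℝ := 1 / (β - 2 * s) + 13 * ∑' n : ℕ, ((n : ℝ) + 1) ^ (-(1 + 2 * s)) with hB
  have hB0 : 0 < B := by
    have h1 : 0 < 1 / (β - 2 * s) := one_div_pos.2 (by linarith)
    have h2 : 0 ≤ ∑' n : ℕ, ((n : ℝ) + 1) ^ (-(1 + 2 * s)) := tsum_nonneg fun n => by positivity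
    positivity
  refine ⟨(|cs s| + 1) * B * 2, by positivity, fun h hh j u L ⟨M, hM⟩ hu => ?_⟩
  have hL : 0 ≤ L := by
    have := (abs_nonneg _).trans (hu 1 0)
    simpa using this
  set x : ℝ := h * j
  set g : ℝ → ℝ := fun t => 2 * u x - u (x + h * t) - u (x - h * t) with hg
  have hgM : ∀ t, |g t| ≤ 4 * M := fun t => by
    have h1 := abs_le.1 (hM x)
    have h2 := abs_le.1 (hM (x + h * t))
    have h3 := abs_le.1 (hM (x - h * t))
    rw [abs_le]
    constructor <;> simp only [hg] <;> linarith
  have hgH : ∀ t r, |g t - g r| ≤ 2 * L * h ^ β * |t - r| ^ β := fun t r => by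
    have hscale : |h * (t - r)| ^ β = h ^ β * |t - r| ^ β := by
      rw [abs_mul, abs_of_pos hh, Real.mul_rpow hh.le (abs_nonneg _)]
    have h1 := hu (x + h * t) (x + h * r)
    have h2 := hu (x - h * t) (x - h * r)
    rw [show x + h * t - (x + h * r) = h * (t - r) by ring, hscale] at h1
    rw [show x - h * t - (x - h * r) = -(h * (t - r)) by ring, abs_neg, hscale] at h2
    rw [show g t - g r = -((u (x + h * t) - u (x + h * r)) + (u (x - h * t) - u (x - h * r))) by
      simp only [hg]; ring, abs_neg]
    refine (abs_add_le _ _).trans ((add_le_add h1 h2).trans_eq ?_)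
    ring
  have hmain := abs_tsum_sub_integral_le hβ0 hβ1 hs0 hsβ (by positivity) hgM
    (by simp only [hg]; ring_nf) hgH
  rw [fracDiscLap_eq hs0 (by linarith) u j hM, fracLap_eq hh, ← mul_sub, ← mul_sub, abs_mul,
    abs_mul, abs_of_pos (Real.rpow_pos_of_pos hh _)]
  calc _ ≤ h ^ (-(2 * s)) * (|cs s| * (B * (2 * L * h ^ β))) := by
        gcongr
    _ ≤ h ^ (-(2 * s)) * ((|cs s| + 1) * (B * (2 * L * h ^ β))) := by
        gcongr
        linarith
    _ = _ := by
        rw [sub_eq_add_neg, Real.rpow_add hh]; ring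
end

section
/- Let 0<s<1/2 and set c_{−s} = 4^{−s} Γ(1/2−s)/(√π Γ(s)). There exists a constant C_s>0 depending only on s such that for every m ∈ ℤ with m≠0, | K_{−s}(m) − c_{−s}/|m|^{1−2s} | ≤ C_s / |m|^{2−2s}, where K_{−s}(m) = 4^{−s} Γ(1/2−s) Γ(|m|+s) / (√π Γ(s) Γ(|m|+1−s)). -/
open Real

/-- The kernel of the one-dimensional fractional discrete integral
`K_{−s}(m) = 4^{−s} Γ(1/2−s) Γ(|m|+s) / (√π Γ(s) Γ(|m|+1−s))` for `m ≠ 0`. -/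
noncomputable def Kneg (s : ℝ) (m : ℤ) : ℝ :=
  4 ^ (-s) * Real.Gamma (1 / 2 - s) * Real.Gamma (|(m : ℝ)| + s) /
    (Real.sqrt Real.pi * Real.Gamma s * Real.Gamma (|(m : ℝ)| + 1 - s))

/-- The constant `c_{−s} = 4^{−s} Γ(1/2−s)/(√π Γ(s))`. -/
noncomputable def cneg (s : ℝ) : ℝ :=
  4 ^ (-s) * Real.Gamma (1 / 2 - s) / (Real.sqrt Real.pi * Real.Gamma s)

/-- Gautschi's upper bound, a consequence of the log-convexity of `Γ`. -/
theorem Gamma_add_le_Gamma_mul_rpow {x t : ℝ} (hx : 0 < x) (ht0 : 0 < t) (ht1 : t < 1) :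
    Real.Gamma (x + t) ≤ Real.Gamma x * x ^ t := by
  have hG : 0 < Real.Gamma x := Real.Gamma_pos_of_pos hx
  have h := Real.Gamma_mul_add_mul_le_rpow_Gamma_mul_rpow_Gamma (s := x) (t := x + 1)
    (a := 1 - t) (b := t) hx (by linarith) (by linarith) ht0 (by ring)
  rw [show (1 - t) * x + t * (x + 1) = x + t by ring, Real.Gamma_add_one hx.ne',
    Real.mul_rpow hx.le hG.le] at h
  have hsplit : Real.Gamma x ^ (1 - t) * Real.Gamma x ^ t = Real.Gamma x := by
    rw [← Real.rpow_add hG, sub_add_cancel, Real.rpow_one]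
  calc Real.Gamma (x + t) ≤ Real.Gamma x ^ (1 - t) * (x ^ t * Real.Gamma x ^ t) := h
    _ = (Real.Gamma x ^ (1 - t) * Real.Gamma x ^ t) * x ^ t := by ring
    _ = Real.Gamma x * x ^ t := by rw [hsplit]

theorem Gamma_mul_rpow_le_Gamma_add_mul {x t : ℝ} (hx : 0 < x) (ht0 : 0 < t) (ht1 : t < 1) :
    Real.Gamma x * x ^ t ≤ Real.Gamma (x + t) * (1 + 1 / x) := by
  have hxt : 0 < x + t := by linarith
  have hG : 0 < Real.Gamma (x + t) := Real.Gamma_pos_of_pos hxt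
  have h := Gamma_add_le_Gamma_mul_rpow hxt (t := 1 - t) (by linarith) (by linarith)
  rw [show x + t + (1 - t) = x + 1 by ring, Real.Gamma_add_one hx.ne'] at h
  have hfac : (x + t) ^ (1 - t) ≤ x ^ (1 - t) * (1 + 1 / x) := by
    calc (x + t) ^ (1 - t) ≤ (x * (1 + 1 / x)) ^ (1 - t) := by
          refine Real.rpow_le_rpow hxt.le ?_ (by linarith)
          rw [mul_add, mul_one, mul_one_div_cancel hx.ne']
          linarith
      _ = x ^ (1 - t) * (1 + 1 / x) ^ (1 - t) := Real.mul_rpow hx.le (by positivity)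
      _ ≤ x ^ (1 - t) * (1 + 1 / x) := by
          gcongr
          exact Real.rpow_le_self_of_one_le (le_add_of_nonneg_right (by positivity)) (by linarith)
  have hsplit : x ^ t * x ^ (1 - t) = x := by
    rw [← Real.rpow_add hx, add_sub_cancel, Real.rpow_one]
  refine le_of_mul_le_mul_right ?_ (Real.rpow_pos_of_pos hx (1 - t))
  calc Real.Gamma x * x ^ t * x ^ (1 - t) = (x ^ t * x ^ (1 - t)) * Real.Gamma x := by ring
    _ = x * Real.Gamma x := by rw [hsplit]
    _ ≤ Real.Gamma (x + t) * (x + t) ^ (1 - t) := h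
    _ ≤ Real.Gamma (x + t) * (x ^ (1 - t) * (1 + 1 / x)) := by gcongr
    _ = Real.Gamma (x + t) * (1 + 1 / x) * x ^ (1 - t) := by ring

theorem abs_Gamma_div_Gamma_sub_rpow_le {x s : ℝ} (hx : 0 < x) (hs0 : 0 < s) (hs1 : s < 1) :
    |Real.Gamma (x + s) / Real.Gamma (x + 1 - s) - 1 / x ^ (1 - 2 * s)| ≤
      1 / x ^ (2 - 2 * s) := by
  rw [add_sub_assoc]
  have hG : 0 < Real.Gamma x := Real.Gamma_pos_of_pos hx
  have hB : 0 < Real.Gamma (x + (1 - s)) := Real.Gamma_pos_of_pos (by linarith)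
  have hA_le := Gamma_add_le_Gamma_mul_rpow hx hs0 hs1
  have hle_A := Gamma_mul_rpow_le_Gamma_add_mul hx hs0 hs1
  have hB_le := Gamma_add_le_Gamma_mul_rpow hx (t := 1 - s) (by linarith) (by linarith)
  have hle_B := Gamma_mul_rpow_le_Gamma_add_mul hx (t := 1 - s) (by linarith) (by linarith)
  have hp : 0 < x ^ (1 - 2 * s) := Real.rpow_pos_of_pos hx _
  have hsplit : x ^ (1 - s) = x ^ s * x ^ (1 - 2 * s) := by
    rw [← Real.rpow_add hx]; congr 1; ring
  have hsplit' : x ^ (2 - 2 * s) = x ^ (1 - 2 * s) * x := by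
    rw [← Real.rpow_add_one hx.ne']; congr 1; ring
  rw [hsplit] at hB_le hle_B
  rw [hsplit']
  generalize Real.Gamma (x + s) = A at *
  generalize Real.Gamma (x + (1 - s)) = B at *
  generalize x ^ (1 - 2 * s) = p at *
  have hupper : A * p ≤ B * (1 + 1 / x) := by
    calc A * p ≤ Real.Gamma x * x ^ s * p := by gcongr
      _ = Real.Gamma x * (x ^ s * p) := by ring
      _ ≤ _ := hle_B
  have hlower : B ≤ A * p * (1 + 1 / x) := by
    calc B ≤ Real.Gamma x * (x ^ s * p) := hB_le
      _ = Real.Gamma x * x ^ s * p := by ring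
      _ ≤ A * (1 + 1 / x) * p := by gcongr
      _ = _ := by ring
  have hfactor : A / B - 1 / p = (A * p / B - 1) / p := by field_simp
  rw [hfactor, abs_div, abs_of_pos hp, mul_comm p x, ← div_div]
  refine div_le_div_of_nonneg_right ?_ hp.le
  have hy : 0 < 1 / x := by positivity
  have hr_le : A * p / B ≤ 1 + 1 / x := by
    rw [div_le_iff₀ hB]; linarith
  have hle_r : 1 ≤ A * p / B * (1 + 1 / x) := by
    rw [div_mul_eq_mul_div, le_div_iff₀ hB]; linarith
  rw [abs_le]
  constructor <;> nlinarith

theorem fractional_integral_kernel_asymptotics (s : ℝ) (hs0 : 0 < s) (hs1 : s < 1 / 2) :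
    ∃ C : ℝ, 0 < C ∧ ∀ m : ℤ, m ≠ 0 →
      |Kneg s m - cneg s / |(m : ℝ)| ^ (1 - 2 * s)| ≤ C / |(m : ℝ)| ^ (2 - 2 * s) := by
  have hc : 0 < cneg s := by
    have h₁ : 0 < Real.Gamma (1 / 2 - s) := Real.Gamma_pos_of_pos (by linarith)
    have h₂ : 0 < Real.Gamma s := Real.Gamma_pos_of_pos hs0
    unfold cneg
    positivity
  refine ⟨cneg s, hc, fun m hm => ?_⟩
  have hx : 0 < |(m : ℝ)| := abs_pos.mpr (Int.cast_ne_zero.mpr hm)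
  have hK : Kneg s m =
      cneg s * (Real.Gamma (|(m : ℝ)| + s) / Real.Gamma (|(m : ℝ)| + 1 - s)) := by
    rw [Kneg, cneg, div_mul_div_comm]
  rw [hK, ← mul_one_div (cneg s), ← mul_one_div (cneg s), ← mul_sub, abs_mul, abs_of_pos hc]
  exact mul_le_mul_of_nonneg_left
    (abs_Gamma_div_Gamma_sub_rpow_le hx hs0 (by linarith)) hc.le
end
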